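/- arXiv:1211.3174 — 9 statements merged into one kernel-verified Lean document; each statement's English description precedes it below -/
import Mathlib

section
/- For every i \geq 0 and j \geq 1, A(i,j) = \left[\frac{q_1(1-q_2)}{1-q_1 q_2}\right]^j \sum_{m=0}^{i} \sum_{t=0}^{j} \frac{i-m}{1-q_1} \left[\frac{(1-q_1) q_2}{1-q_1 q_2}\right]^m \binom{j}{t} \binom{m+j-t-1}{j-1} \left(\frac{1-q_1 q_2}{q_1 q_2}\right)^t + \frac{j}{1-q_2}, where the binomial coefficient \binom{u}{v} with integer arguments is taken to be 0 whenever u < 0 or u < v. (This gives an exact characterization of the expectation of the maximum of two independent negative binomial random variables.) -/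
open Finset

/-- Binomial coefficient with integer arguments: `zbinom u v = u.choose v` when
`0 ≤ v ≤ u`, and `0` whenever `u < 0` or `u < v` (or `v < 0`). -/
noncomputable def zbinom (u v : ℤ) : ℝ :=
  if 0 ≤ u ∧ 0 ≤ v ∧ v ≤ u then (Nat.choose u.toNat v.toNat : ℝ) else 0

open PowerSeries in
lemma geom_pow_coeff (b : ℝ) (d n : ℕ) :
    coeff n ((PowerSeries.mk fun n => b ^ n) ^ (d + 1)) = b ^ n * (Nat.choose (d + n) d : ℝ) := by
  have h : (PowerSeries.mk fun n => b ^ n) = rescale b (PowerSeries.mk 1) := by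
    ext n; simp [coeff_rescale]
  rw [h, ← map_pow, mk_one_pow_eq_mk_choose_add, coeff_rescale, coeff_mk]

open PowerSeries in
lemma coeff_aux (a b r : ℝ) (d m : ℕ) :
    coeff m ((C a + C (a * b * r) * X) ^ (d + 1) * (PowerSeries.mk fun n => b ^ n) ^ (d + 1)) =
      a ^ (d + 1) * ∑ t ∈ Finset.range (d + 1 + 1), b ^ m * (Nat.choose (d + 1) t : ℝ) *
        zbinom ((m : ℤ) + (d + 1 : ℕ) - t - 1) (((d + 1 : ℕ) : ℤ) - 1) * r ^ t := by
  rw [add_comm (C a), add_pow, Finset.sum_mul, map_sum, Finset.mul_sum]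
  refine Finset.sum_congr rfl fun t ht => ?_
  have ht' : t ≤ d + 1 := by simp at ht; omega
  have e : (C (a * b * r) * X) ^ t * (C a) ^ (d + 1 - t) * (((d + 1).choose t : ℕ) : PowerSeries ℝ) *
      (PowerSeries.mk fun n => b ^ n) ^ (d + 1) =
      C ((a * b * r) ^ t * a ^ (d + 1 - t) * ((d + 1).choose t : ℝ)) *
        (X ^ t * (PowerSeries.mk fun n => b ^ n) ^ (d + 1)) := by
    simp only [map_mul, map_pow, map_natCast]
    ring
  rw [e, coeff_C_mul, coeff_X_pow_mul']
  have ea : a ^ (d + 1) = a ^ t * a ^ (d + 1 - t) := by rw [← pow_add]; congr 1; omega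
  split_ifs with h
  · obtain ⟨k, rfl⟩ := Nat.exists_eq_add_of_le h
    have hz : zbinom (((t + k : ℕ) : ℤ) + (d + 1 : ℕ) - t - 1) (((d + 1 : ℕ) : ℤ) - 1) =
        (Nat.choose (d + k) d : ℝ) := by
      unfold zbinom
      rw [if_pos (by push_cast; omega)]
      congr 2 <;> push_cast <;> omega
    rw [hz, Nat.add_sub_cancel_left, geom_pow_coeff, ea, mul_pow, mul_pow, pow_add]
    ring
  · have hz : zbinom ((m : ℤ) + (d + 1 : ℕ) - t - 1) (((d + 1 : ℕ) : ℤ) - 1) = 0 := by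
      unfold zbinom
      rw [if_neg (by push_cast; omega)]
    rw [hz]; ring

open PowerSeries in
lemma coeff_formula (a b r : ℝ) (B : ℕ → ℕ → ℝ) (h0 : ∀ j, B 0 j = 0)
    (hr : ∀ i j, B (i + 1) (j + 1) = b * B i (j + 1) + a * B (i + 1) j + a * b * r * B i j)
    (i d : ℕ) :
    B i (d + 1) = a ^ (d + 1) * ∑ m ∈ Finset.range (i + 1), ∑ t ∈ Finset.range (d + 1 + 1),
      B (i - m) 0 * b ^ m * (Nat.choose (d + 1) t : ℝ) *
        zbinom ((m : ℤ) + (d + 1 : ℕ) - t - 1) (((d + 1 : ℕ) : ℤ) - 1) * r ^ t := by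
  set H : PowerSeries ℝ := PowerSeries.mk fun n => b ^ n with hH
  have hinv : H * (1 - C b * X) = 1 := by
    have h : H = rescale b (PowerSeries.mk 1) := by
      ext n; simp [coeff_rescale, hH]
    have h2 : (1 - C b * X : PowerSeries ℝ) = rescale b (1 - X) := by
      simp [rescale_X]
    rw [h, h2, ← map_mul, mk_one_mul_one_sub_eq_one, map_one]
  have hstep : ∀ j, (1 - C b * X) * PowerSeries.mk (fun i => B i (j + 1)) =
      (C a + C (a * b * r) * X) * PowerSeries.mk (fun i => B i j) := by
    intro j
    ext n
    cases n with
    | zero => simp [sub_mul, add_mul, mul_assoc, h0]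
    | succ n =>
      simp only [sub_mul, add_mul, mul_assoc, one_mul, map_sub, map_add, coeff_C_mul, coeff_mk,
        coeff_succ_X_mul]
      rw [hr]; ring
  have hall : ∀ j, PowerSeries.mk (fun i => B i j) =
      (C a + C (a * b * r) * X) ^ j * H ^ j * PowerSeries.mk (fun i => B i 0) := by
    intro j
    induction j with
    | zero => simp
    | succ j ih =>
      calc PowerSeries.mk (fun i => B i (j + 1))
          = H * ((1 - C b * X) * PowerSeries.mk (fun i => B i (j + 1))) := by
            rw [← mul_assoc, hinv, one_mul]
        _ = _ := by rw [hstep, ih]; ring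
  have := congrArg (coeff i) (hall (d + 1))
  rw [coeff_mk, coeff_mul, Finset.Nat.sum_antidiagonal_eq_sum_range_succ_mk] at this
  rw [this, Finset.mul_sum]
  refine Finset.sum_congr rfl fun m _ => ?_
  rw [coeff_aux, coeff_mk, mul_assoc, Finset.sum_mul]
  congr 1
  refine Finset.sum_congr rfl fun t _ => ?_
  ring

/-- Let `q₁, q₂ ∈ (0,1)` and let `A : ℕ × ℕ → ℝ` satisfy the boundary
conditions `A i 0 = i/(1-q₁)`, `A 0 j = j/(1-q₂)`, `A 0 0 = 0` and, for `i, j ≥ 1`, the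
recurrence
`(1 - q₁q₂) A i j = (1-q₁)q₂ A (i-1) j + q₁(1-q₂) A i (j-1) + (1-q₁)(1-q₂) A (i-1) (j-1) + 1`.
Then for every `i ≥ 0` and `j ≥ 1`,
`A i j = [q₁(1-q₂)/(1-q₁q₂)]^j ∑_{m=0}^{i} ∑_{t=0}^{j} (i-m)/(1-q₁) [(1-q₁)q₂/(1-q₁q₂)]^m
  C(j,t) C(m+j-t-1, j-1) [(1-q₁q₂)/(q₁q₂)]^t + j/(1-q₂)`,
where the binomial coefficient `C(u,v)` is `0` whenever `u < 0` or `u < v`.  (This gives an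
exact characterization of the expectation of the maximum of two independent negative
binomial random variables.) -/
theorem expected_max_negative_binomial (q1 q2 : ℝ)
    (hq1 : q1 ∈ Set.Ioo (0 : ℝ) 1) (hq2 : q2 ∈ Set.Ioo (0 : ℝ) 1)
    (A : ℕ → ℕ → ℝ)
    (hA10 : ∀ i : ℕ, A i 0 = (i : ℝ) / (1 - q1))
    (hA01 : ∀ j : ℕ, A 0 j = (j : ℝ) / (1 - q2))
    (hA00 : A 0 0 = 0)
    (hrec : ∀ i j : ℕ, 1 ≤ i → 1 ≤ j →
      (1 - q1 * q2) * A i j =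
        (1 - q1) * q2 * A (i - 1) j + q1 * (1 - q2) * A i (j - 1) +
          (1 - q1) * (1 - q2) * A (i - 1) (j - 1) + 1) :
    ∀ i j : ℕ, 1 ≤ j →
      A i j =
        (q1 * (1 - q2) / (1 - q1 * q2)) ^ j *
          (∑ m ∈ Finset.range (i + 1), ∑ t ∈ Finset.range (j + 1),
            ((i : ℝ) - m) / (1 - q1) * ((1 - q1) * q2 / (1 - q1 * q2)) ^ m *
              (Nat.choose j t : ℝ) * zbinom ((m : ℤ) + j - t - 1) ((j : ℤ) - 1) *
              ((1 - q1 * q2) / (q1 * q2)) ^ t) +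
        (j : ℝ) / (1 - q2) := by
  obtain ⟨h10, h11⟩ := hq1
  obtain ⟨h20, h21⟩ := hq2
  have e1 : 1 - q1 ≠ 0 := by linarith
  have e2 : 1 - q2 ≠ 0 := by linarith
  have e12 : 1 - q1 * q2 ≠ 0 := by nlinarith
  have n1 : q1 ≠ 0 := h10.ne'
  have n2 : q2 ≠ 0 := h20.ne'
  intro i j hj
  obtain ⟨d, rfl⟩ : ∃ d, j = d + 1 := ⟨j - 1, by omega⟩
  have key := coeff_formula (q1 * (1 - q2) / (1 - q1 * q2)) ((1 - q1) * q2 / (1 - q1 * q2))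
    ((1 - q1 * q2) / (q1 * q2)) (fun i j => A i j - (j : ℝ) / (1 - q2))
    (by intro j; simp [hA01])
    (by
      intro i j
      have h := hrec (i + 1) (j + 1) (by omega) (by omega)
      simp only [Nat.add_sub_cancel] at h
      have h' : A (i + 1) (j + 1) = ((1 - q1) * q2 * A i (j + 1) + q1 * (1 - q2) * A (i + 1) j +
          (1 - q1) * (1 - q2) * A i j + 1) / (1 - q1 * q2) := by
        rw [eq_div_iff e12]; linarith
      simp only [h']
      push_cast
      field_simp
      ring) i d
  rw [← sub_eq_iff_eq_add]
  refine key.trans ?_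
  congr 1
  refine Finset.sum_congr rfl fun m hm => Finset.sum_congr rfl fun t _ => ?_
  have hm' : m ≤ i := by simp at hm; omega
  rw [hA10]
  simp only [Nat.cast_zero, zero_div, sub_zero, Nat.cast_sub hm']
end

section
/- There exist a constant c > 0 and a threshold N such that for all natural numbers M, T satisfying M(1-q_2) = T(1-q_1) and M + T \geq N, one has A(M, T) - \frac{M+T}{2 - q_1 - q_2} \geq c\,\sqrt{M+T}. In other words, the excess delay U_n := A(M,T) - n/(2-q_1-q_2) of routing over two parallel erasure links (with n = M + T packets split proportionally to the link capacities, M/(1-q_1) = T/(1-q_2)) is unbounded and grows at least as the square root of n. -/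
/-- Lower bound polynomial: the expectation of `r t² - r³ t⁴` after `k` walk steps from `d`. -/
noncomputable def walkPoly (v m3 m4 r : ℝ) (k : ℕ) (d : ℝ) : ℝ :=
  r * (d ^ 2 + v * k) -
    r ^ 3 * (d ^ 4 + 6 * k * v * d ^ 2 - 4 * k * m3 * d + (k * m4 + 3 * k * (k - 1) * v ^ 2))

theorem walkPoly_step (w0 w1 w2 w3 e1 e2 e3 v m3 m4 r d : ℝ) (k : ℕ)
    (hw : w0 + w1 + w2 + w3 = 1)
    (h1 : w1 * e1 + w2 * e2 + w3 * e3 = 0)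
    (h2 : w1 * e1 ^ 2 + w2 * e2 ^ 2 + w3 * e3 ^ 2 = v)
    (h3 : w1 * e1 ^ 3 + w2 * e2 ^ 3 + w3 * e3 ^ 3 = m3)
    (h4 : w1 * e1 ^ 4 + w2 * e2 ^ 4 + w3 * e3 ^ 4 = m4) :
    walkPoly v m3 m4 r (k + 1) d =
      w0 * walkPoly v m3 m4 r k d + w1 * walkPoly v m3 m4 r k (d - e1) +
        w2 * walkPoly v m3 m4 r k (d - e2) + w3 * walkPoly v m3 m4 r k (d - e3) := by
  have e : w0 = 1 - w1 - w2 - w3 := by linarith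
  unfold walkPoly
  push_cast
  rw [e]
  linear_combination (2 * r * d - r ^ 3 * (4 * d ^ 3 + 12 * k * v * d - 4 * k * m3)) * h1 +
    (- r + r ^ 3 * (6 * d ^ 2 + 6 * k * v)) * h2 - 4 * d * r ^ 3 * h3 + r ^ 3 * h4

theorem walkPoly_zero_le (v m3 m4 r d : ℝ) (hr : 0 < r) : walkPoly v m3 m4 r 0 d ≤ |d| := by
  have h : walkPoly v m3 m4 r 0 d = r * |d| ^ 2 - r ^ 3 * |d| ^ 4 := by
    have e4 : |d| ^ 4 = d ^ 4 := by
      rw [show |d| ^ 4 = (|d| ^ 2) ^ 2 by ring, sq_abs]; ring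
    rw [e4, sq_abs]
    simp [walkPoly]
  rw [h]
  set t := |d|
  have ht : 0 ≤ t := abs_nonneg d
  have hu : 0 ≤ r * t := by positivity
  have key : 0 ≤ 1 - r * t + (r * t) ^ 3 := by
    rcases le_total (r * t) 1 with h | h
    · have : 0 ≤ (r * t) ^ 3 := by positivity
      linarith
    · nlinarith [mul_nonneg hu (sub_nonneg.2 h), mul_nonneg (mul_nonneg hu hu) (sub_nonneg.2 h)]
  nlinarith [mul_nonneg ht key]

theorem A_ge_max (q1 q2 : ℝ)
    (hq1 : q1 ∈ Set.Ioo (0 : ℝ) 1) (hq2 : q2 ∈ Set.Ioo (0 : ℝ) 1)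
    (a b : ℝ) (ha : (1 - q1) * a = 1) (hb : (1 - q2) * b = 1)
    (A : ℕ → ℕ → ℝ)
    (hA10 : ∀ i : ℕ, A i 0 = i * a)
    (hA01 : ∀ j : ℕ, A 0 j = j * b)
    (hrec : ∀ i j : ℕ, 
      (1 - q1 * q2) * A (i + 1) (j + 1) =
        (1 - q1) * q2 * A i (j + 1) + q1 * (1 - q2) * A (i + 1) j +
          (1 - q1) * (1 - q2) * A i j + 1) :
    ∀ i j : ℕ, (i : ℝ) * a ≤ A i j ∧ (j : ℝ) * b ≤ A i j := by
  obtain ⟨h1, h1'⟩ := hq1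
  obtain ⟨h2, h2'⟩ := hq2
  have ha0 : 0 < a := by
    by_contra h
    nlinarith
  have hb0 : 0 < b := by
    by_contra h
    nlinarith
  have w1 : 0 < (1 - q1) * q2 := mul_pos (by linarith) h2
  have w2 : 0 < q1 * (1 - q2) := mul_pos h1 (by linarith)
  have w3 : 0 < (1 - q1) * (1 - q2) := mul_pos (by linarith) (by linarith)
  have hq : 0 < 1 - q1 * q2 := by nlinarith
  intro i
  induction i with
  | zero =>
    intro j
    rw [hA01]
    constructor
    · simp only [Nat.cast_zero, zero_mul]; positivity
    · exact le_rfl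
  | succ i ihi =>
    intro j
    induction j with
    | zero =>
      rw [hA10]
      constructor
      · exact le_rfl
      · simp only [Nat.cast_zero, zero_mul]; positivity
    | succ j ihj =>
      have r := hrec i j
      obtain ⟨x1, y1⟩ := ihi (j + 1)
      obtain ⟨x2, y2⟩ := ihj
      obtain ⟨x3, y3⟩ := ihi j
      push_cast at *
      constructor
      · refine le_of_mul_le_mul_left ?_ hq
        have := mul_le_mul_of_nonneg_left x1 w1.le
        have := mul_le_mul_of_nonneg_left x2 w2.le
        have := mul_le_mul_of_nonneg_left x3 w3.le
        nlinarith
      · refine le_of_mul_le_mul_left ?_ hq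
        have := mul_le_mul_of_nonneg_left y1 w1.le
        have := mul_le_mul_of_nonneg_left y2 w2.le
        have := mul_le_mul_of_nonneg_left y3 w3.le
        nlinarith

theorem A_ge_poly (q1 q2 : ℝ)
    (hq1 : q1 ∈ Set.Ioo (0 : ℝ) 1) (hq2 : q2 ∈ Set.Ioo (0 : ℝ) 1)
    (a b : ℝ) (ha : (1 - q1) * a = 1) (hb : (1 - q2) * b = 1)
    (A : ℕ → ℕ → ℝ)
    (hA10 : ∀ i : ℕ, A i 0 = i * a)
    (hA01 : ∀ j : ℕ, A 0 j = j * b)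
    (hrec : ∀ i j : ℕ, 
      (1 - q1 * q2) * A (i + 1) (j + 1) =
        (1 - q1) * q2 * A i (j + 1) + q1 * (1 - q2) * A (i + 1) j +
          (1 - q1) * (1 - q2) * A i j + 1)
    (v m3 m4 r : ℝ) (hr : 0 < r)
    (h2 : (1 - q1) * q2 * a ^ 2 + q1 * (1 - q2) * (-b) ^ 2
      + (1 - q1) * (1 - q2) * (a - b) ^ 2 = v)
    (h3 : (1 - q1) * q2 * a ^ 3 + q1 * (1 - q2) * (-b) ^ 3
      + (1 - q1) * (1 - q2) * (a - b) ^ 3 = m3)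
    (h4 : (1 - q1) * q2 * a ^ 4 + q1 * (1 - q2) * (-b) ^ 4
      + (1 - q1) * (1 - q2) * (a - b) ^ 4 = m4) :
    ∀ k i j : ℕ, k ≤ i → k ≤ j →
      i * a + j * b + walkPoly v m3 m4 r k (i * a - j * b) ≤ 2 * A i j := by
  have hmax := A_ge_max q1 q2 hq1 hq2 a b ha hb A hA10 hA01 hrec
  obtain ⟨g1, g1'⟩ := hq1
  obtain ⟨g2, g2'⟩ := hq2
  have w0 : 0 < q1 * q2 := mul_pos g1 g2
  have w1 : 0 < (1 - q1) * q2 := mul_pos (by linarith) g2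
  have w2 : 0 < q1 * (1 - q2) := mul_pos g1 (by linarith)
  have w3 : 0 < (1 - q1) * (1 - q2) := mul_pos (by linarith) (by linarith)
  intro k
  induction k with
  | zero =>
    intro i j _ _
    have h := walkPoly_zero_le v m3 m4 r (i * a - j * b) hr
    obtain ⟨hx, hy⟩ := hmax i j
    rcases abs_cases ((i : ℝ) * a - j * b) with ⟨e, _⟩ | ⟨e, _⟩ <;> rw [e] at h <;> linarith
  | succ k ih =>
    intro i j hi hj
    obtain ⟨i, rfl⟩ : ∃ i', i = i' + 1 := ⟨i - 1, by omega⟩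
    obtain ⟨j, rfl⟩ : ∃ j', j = j' + 1 := ⟨j - 1, by omega⟩
    have r0 := ih (i + 1) (j + 1) (by omega) (by omega)
    have r1 := ih i (j + 1) (by omega) (by omega)
    have r2 := ih (i + 1) j (by omega) (by omega)
    have r3 := ih i j (by omega) (by omega)
    have hr := hrec i j
    push_cast at *
    rw [walkPoly_step (q1 * q2) ((1 - q1) * q2) (q1 * (1 - q2)) ((1 - q1) * (1 - q2)) a (-b) (a - b)
      v m3 m4 r _ k (by ring) (by linear_combination ha - hb) h2 h3 h4]
    rw [show (i : ℝ) * a - (j + 1) * b = (i + 1) * a - (j + 1) * b - a by ring] at r1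
    rw [show ((i : ℝ) + 1) * a - j * b = (i + 1) * a - (j + 1) * b - (-b) by ring] at r2
    rw [show (i : ℝ) * a - j * b = (i + 1) * a - (j + 1) * b - (a - b) by ring] at r3
    have s0 := mul_le_mul_of_nonneg_left r0 w0.le
    have s1 := mul_le_mul_of_nonneg_left r1 w1.le
    have s2 := mul_le_mul_of_nonneg_left r2 w2.le
    have s3 := mul_le_mul_of_nonneg_left r3 w3.le
    linear_combination s0 + s1 + s2 + s3 - 2 * hr + ha + hb

/-- Let `q₁, q₂ ∈ (0,1)` and let `A : ℕ × ℕ → ℝ` be the expected routing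
completion time, characterized by the boundary conditions `A i 0 = i/(1-q₁)`,
`A 0 j = j/(1-q₂)`, `A 0 0 = 0` and, for `i, j ≥ 1`, the recurrence
`(1 - q₁q₂) A i j = (1-q₁)q₂ A (i-1) j + q₁(1-q₂) A i (j-1) + (1-q₁)(1-q₂) A (i-1) (j-1) + 1`.
Then there are `c > 0` and a threshold `N` such that for all naturals `M, T` with
`M(1-q₂) = T(1-q₁)` and `M + T ≥ N`, one has
`A M T - (M+T)/(2 - q₁ - q₂) ≥ c √(M+T)`: the excess delay of routing over two parallel
erasure links (with `n = M + T` packets split proportionally to the link capacities)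
is unbounded and grows at least as `√n`. -/
theorem routing_delay_grows_as_sqrt (q1 q2 : ℝ)
    (hq1 : q1 ∈ Set.Ioo (0 : ℝ) 1) (hq2 : q2 ∈ Set.Ioo (0 : ℝ) 1)
    (A : ℕ → ℕ → ℝ)
    (hA10 : ∀ i : ℕ, A i 0 = (i : ℝ) / (1 - q1))
    (hA01 : ∀ j : ℕ, A 0 j = (j : ℝ) / (1 - q2))
    (hA00 : A 0 0 = 0)
    (hrec : ∀ i j : ℕ, 1 ≤ i → 1 ≤ j →
      (1 - q1 * q2) * A i j =
        (1 - q1) * q2 * A (i - 1) j + q1 * (1 - q2) * A i (j - 1) +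
          (1 - q1) * (1 - q2) * A (i - 1) (j - 1) + 1) :
    ∃ c : ℝ, 0 < c ∧ ∃ N : ℕ, ∀ M T : ℕ,
      (M : ℝ) * (1 - q2) = (T : ℝ) * (1 - q1) → N ≤ M + T →
      c * Real.sqrt ((M : ℝ) + T) ≤ A M T - ((M : ℝ) + T) / (2 - q1 - q2) := by
  have p1 : 0 < 1 - q1 := by linarith [hq1.2]
  have p2 : 0 < 1 - q2 := by linarith [hq2.2]
  obtain ⟨a, ha⟩ : ∃ a, (1 - q1) * a = 1 := ⟨(1 - q1)⁻¹, mul_inv_cancel₀ p1.ne'⟩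
  obtain ⟨b, hb⟩ : ∃ b, (1 - q2) * b = 1 := ⟨(1 - q2)⁻¹, mul_inv_cancel₀ p2.ne'⟩
  have ha0 : 0 < a := by
    by_contra h
    nlinarith
  have hb0 : 0 < b := by
    by_contra h
    nlinarith
  have w1 : 0 < (1 - q1) * q2 := mul_pos p1 hq2.1
  have w2 : 0 < q1 * (1 - q2) := mul_pos hq1.1 p2
  have w3 : 0 < (1 - q1) * (1 - q2) := mul_pos p1 p2
  obtain ⟨v, hv⟩ : ∃ v, (1 - q1) * q2 * a ^ 2 + q1 * (1 - q2) * (-b) ^ 2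
      + (1 - q1) * (1 - q2) * (a - b) ^ 2 = v := ⟨_, rfl⟩
  obtain ⟨m3, hm3⟩ : ∃ v, (1 - q1) * q2 * a ^ 3 + q1 * (1 - q2) * (-b) ^ 3
      + (1 - q1) * (1 - q2) * (a - b) ^ 3 = v := ⟨_, rfl⟩
  obtain ⟨m4, hm4⟩ : ∃ v, (1 - q1) * q2 * a ^ 4 + q1 * (1 - q2) * (-b) ^ 4
      + (1 - q1) * (1 - q2) * (a - b) ^ 4 = v := ⟨_, rfl⟩
  have hv0 : 0 < v := by
    rw [← hv]
    have := mul_pos w1 (pow_pos ha0 2)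
    have := mul_nonneg w2.le (sq_nonneg (-b))
    have := mul_nonneg w3.le (sq_nonneg (a - b))
    linarith
  have hm40 : 0 ≤ m4 := by
    rw [← hm4]
    have := mul_nonneg w1.le (Even.pow_nonneg (by decide : Even 4) a)
    have := mul_nonneg w2.le (Even.pow_nonneg (by decide : Even 4) (-b))
    have := mul_nonneg w3.le (Even.pow_nonneg (by decide : Even 4) (a - b))
    linarith
  have main := A_ge_poly q1 q2 hq1 hq2 a b ha hb A
    (fun i => by rw [hA10, div_eq_iff p1.ne']; linear_combination -(i : ℝ) * ha)
    (fun j => by rw [hA01, div_eq_iff p2.ne']; linear_combination -(j : ℝ) * hb)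
    (fun i j => by simpa using hrec (i + 1) (j + 1) (by omega) (by omega)) v m3 m4
  -- the scale
  obtain ⟨L, hL0, hL⟩ : ∃ L : ℝ, 0 < L ∧ L ^ 2 * (2 * (m4 + 3 * v ^ 2)) = v := by
    have h : 0 < v / (2 * (m4 + 3 * v ^ 2)) := by positivity
    refine ⟨Real.sqrt (v / (2 * (m4 + 3 * v ^ 2))), Real.sqrt_pos.2 h, ?_⟩
    rw [Real.sq_sqrt h.le]
    have : 2 * (m4 + 3 * v ^ 2) ≠ 0 := by positivity
    field_simp
  -- the proportion
  obtain ⟨g, hg0, hg1, hg2⟩ : ∃ g : ℝ, 0 < g ∧ g ^ 2 * (2 - q1 - q2) ≤ 1 - q1 ∧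
      g ^ 2 * (2 - q1 - q2) ≤ 1 - q2 := by
    have hm : 0 < min (1 - q1) (1 - q2) / (2 - q1 - q2) :=
      div_pos (lt_min p1 p2) (by linarith)
    refine ⟨Real.sqrt (min (1 - q1) (1 - q2) / (2 - q1 - q2)), Real.sqrt_pos.2 hm, ?_⟩
    rw [Real.sq_sqrt hm.le, div_mul_cancel₀ _ (by linarith)]
    exact ⟨min_le_left _ _, min_le_right _ _⟩
  refine ⟨v * L / 4 * g, by positivity, 1, ?_⟩
  intro M T hMT hN
  have hs : 0 < 2 - q1 - q2 := by linarith
  have hMT0 : (0 : ℝ) < (M : ℝ) + T := by exact_mod_cast hN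
  have hab : (M : ℝ) * a - T * b = 0 := by
    linear_combination a * b * hMT + (T * b) * ha - (M * a) * hb
  have hx : ((M : ℝ) + T) / (2 - q1 - q2) = M * a := by
    rw [div_eq_iff hs.ne']
    linear_combination -(M : ℝ) * ha - (T : ℝ) * hb - (1 - q2) * hab
  have eM : (M : ℝ) * (2 - q1 - q2) = (M + T) * (1 - q1) := by linear_combination hMT
  have eT : (T : ℝ) * (2 - q1 - q2) = (M + T) * (1 - q2) := by linear_combination -hMT
  have kM : g ^ 2 * ((M : ℝ) + T) ≤ M := by
    refine le_of_mul_le_mul_right ?_ hs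
    nlinarith [mul_le_mul_of_nonneg_left hg1 hMT0.le]
  have kT : g ^ 2 * ((M : ℝ) + T) ≤ T := by
    refine le_of_mul_le_mul_right ?_ hs
    nlinarith [mul_le_mul_of_nonneg_left hg2 hMT0.le]
  obtain ⟨k, hk1, hk2, hk⟩ : ∃ k : ℕ, k ≤ M ∧ k ≤ T ∧ g ^ 2 * ((M : ℝ) + T) ≤ k := by
    refine ⟨min M T, min_le_left _ _, min_le_right _ _, ?_⟩
    rw [Nat.cast_min]
    exact le_min kM kT
  have hkpos : (0 : ℝ) < k := lt_of_lt_of_le (by positivity) hk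
  have hk1' : (1 : ℝ) ≤ k := by exact_mod_cast hkpos
  obtain ⟨s, hs0, hss⟩ : ∃ s : ℝ, 0 < s ∧ s ^ 2 = k :=
    ⟨Real.sqrt k, Real.sqrt_pos.2 hkpos, Real.sq_sqrt hkpos.le⟩
  have hsq : g * Real.sqrt ((M : ℝ) + T) ≤ s := by
    refine (sq_le_sq₀ (by positivity) hs0.le).1 ?_
    rw [mul_pow, Real.sq_sqrt hMT0.le, hss]
    exact hk
  have fin := main (L / s) (by positivity) hv hm3 hm4 k M T hk1 hk2
  rw [hab] at fin
  have hpoly : v * L * s / 2 ≤ walkPoly v m3 m4 (L / s) k 0 := by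
    have e : walkPoly v m3 m4 (L / s) k 0 - v * L * s / 2 =
        (L / s) ^ 3 * (k * (k - 1) * m4 + 3 * k * v ^ 2) := by
      unfold walkPoly
      rw [← hss]
      field_simp
      linear_combination (-s ^ 4) * hL
    have : 0 ≤ (L / s) ^ 3 * (k * (k - 1) * m4 + 3 * k * v ^ 2) := by
      have : (0 : ℝ) ≤ k - 1 := by linarith
      positivity
    linarith
  rw [hx]
  have hc : v * L / 4 * g * Real.sqrt ((M : ℝ) + T) ≤ v * L / 4 * s := by
    rw [mul_assoc]
    exact mul_le_mul_of_nonneg_left hsq (by positivity)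
  linarith
end

section
/- For all natural numbers n and k with 1 \leq k \leq n - 1, the binomial coefficient satisfies \binom{n}{k} > \frac{2^{n H(k/n)}}{\sqrt{2\pi\, k(n-k)/n}} \cdot e^{-\frac{n}{12\,k(n-k)}}. -/
/-- The binary entropy function `H(β) = -β log₂ β - (1-β) log₂(1-β)`. -/
noncomputable def binEnt (b : ℝ) : ℝ :=
  -b * Real.logb 2 b - (1 - b) * Real.logb 2 (1 - b)

open Filter Topology Stirling in
theorem aux_upper (n : ℕ) (hn : 1 ≤ n) :
    Real.log (stirlingSeq n) ≤ 1 / 2 * Real.log Real.pi + 1 / (12 * (n : ℝ)) := by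
  have hmono : Monotone (fun m : ℕ => Real.log (stirlingSeq (m + 1)) - 1 / (12 * ((m : ℝ) + 1))) := by
    apply monotone_nat_of_le_succ
    intro m
    have h := log_stirlingSeq_sdiff_le (m + 1)
    push_cast at h ⊢
    have e : 1 / (12 * ((m : ℝ) + 1) * ((m : ℝ) + 1 + 1)) =
        1 / (12 * ((m : ℝ) + 1)) - 1 / (12 * ((m : ℝ) + 1 + 1)) := by
      field_simp
      ring
    rw [e] at h
    linarith
  have ht : Tendsto (fun m : ℕ => Real.log (stirlingSeq (m + 1)) - 1 / (12 * ((m : ℝ) + 1)))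
      atTop (𝓝 (Real.log (Real.sqrt Real.pi) - 1 / 12 * 0)) := by
    apply Tendsto.sub
    · have h1 := tendsto_stirlingSeq_sqrt_pi.comp (tendsto_add_atTop_nat 1)
      exact h1.log (Real.sqrt_pos.mpr Real.pi_pos).ne'
    · have h2 := (tendsto_one_div_add_atTop_nhds_zero_nat (𝕜 := ℝ)).const_mul (1 / 12 : ℝ)
      refine h2.congr fun m => ?_
      field_simp
  have h := hmono.ge_of_tendsto ht (n - 1)
  obtain ⟨m, rfl⟩ : ∃ m, n = m + 1 := ⟨n - 1, by omega⟩
  rw [Real.log_sqrt Real.pi_pos.le] at h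
  simp only [Nat.add_sub_cancel] at h
  push_cast
  linarith

open Filter Topology Stirling in
theorem aux_lower (n : ℕ) (hn : 1 ≤ n) :
    1 / 2 * Real.log Real.pi < Real.log (stirlingSeq n) := by
  obtain ⟨m, rfl⟩ : ∃ m, n = m + 1 := ⟨n - 1, by omega⟩
  have h1 := sqrt_pi_le_stirlingSeq (n := m + 2) (by omega)
  have h2 := Real.log_le_log (Real.sqrt_pos.mpr Real.pi_pos) h1
  rw [Real.log_sqrt Real.pi_pos.le] at h2
  have h3 := sum_le_hasSum {0} (fun i _ => by positivity) (log_stirlingSeq_sdiff_hasSum m)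
  rw [Finset.sum_singleton] at h3
  have h4 : (0 : ℝ) < 1 / (2 * ((0 + 1 : ℕ) : ℝ) + 1) *
    ((1 / (2 * ((m + 1 : ℕ) : ℝ) + 1)) ^ 2) ^ (0 + 1) := by positivity
  linarith

theorem aux_fact (n : ℕ) (hn : 1 ≤ n) :
    Real.log (n.factorial : ℝ) = Real.log (Stirling.stirlingSeq n) + 1 / 2 * Real.log 2
      + 1 / 2 * Real.log n + n * Real.log n - n := by
  have h := Stirling.log_stirlingSeq_formula n
  have hn' : (0 : ℝ) < n := by exact_mod_cast hn
  rw [Real.log_mul (by norm_num) hn'.ne', Real.log_div hn'.ne' (Real.exp_pos 1).ne',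
    Real.log_exp] at h
  linarith

/-- For all naturals `n, k` with `1 ≤ k ≤ n - 1`, the binomial coefficient
satisfies `C(n,k) > 2^{n H(k/n)} / √(2π k(n-k)/n) · e^{-n/(12 k(n-k))}`, where `H` is the
binary entropy function. -/
theorem choose_gt_stirling_lower_bound (n k : ℕ) (hk1 : 1 ≤ k) (hk2 : k ≤ n - 1) :
    (2 : ℝ) ^ ((n : ℝ) * binEnt ((k : ℝ) / (n : ℝ))) /
        Real.sqrt (2 * Real.pi * ((k : ℝ) * ((n : ℝ) - (k : ℝ))) / (n : ℝ)) *
        Real.exp (-((n : ℝ) / (12 * ((k : ℝ) * ((n : ℝ) - (k : ℝ)))))) <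
      (n.choose k : ℝ) := by
  obtain ⟨j, rfl⟩ : ∃ j, n = k + j := ⟨n - k, by omega⟩
  have hj1 : 1 ≤ j := by omega
  have hk : (0 : ℝ) < k := by exact_mod_cast hk1
  have hj : (0 : ℝ) < j := by exact_mod_cast hj1
  have hC : (0 : ℝ) < ((k + j).choose k : ℝ) := by
    exact_mod_cast Nat.choose_pos (by omega)
  have hlogC : Real.log ((k + j).choose k : ℝ) = Real.log ((k + j).factorial : ℝ)
      - Real.log (k.factorial : ℝ) - Real.log (j.factorial : ℝ) := by
    have h : ((k + j).choose k : ℝ) * k.factorial * j.factorial = (k + j).factorial := by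
      have := Nat.choose_mul_factorial_mul_factorial (n := k + j) (k := k) (by omega)
      rw [Nat.add_sub_cancel_left] at this
      exact_mod_cast this
    rw [← h, Real.log_mul (by positivity) (by positivity),
      Real.log_mul (by positivity) (by positivity)]
    ring
  rw [aux_fact _ hk1, aux_fact _ hj1, aux_fact (k + j) (by omega)] at hlogC
  have u1 := aux_upper k hk1
  have u2 := aux_upper j hj1
  have l := aux_lower (k + j) (by omega)
  push_cast at *
  have e1 : (k : ℝ) + j - k = j := by ring
  rw [e1]
  have hkj : (0 : ℝ) < k + j := by positivity
  have hpi := Real.pi_pos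
  rw [← Real.log_lt_log_iff (by positivity) hC, Real.log_mul (by positivity) (by positivity),
    Real.log_div (by positivity) (by positivity), Real.log_rpow (by norm_num), Real.log_exp,
    Real.log_sqrt (by positivity), Real.log_div (by positivity) (by positivity),
    Real.log_mul (by positivity) (by positivity), Real.log_mul (by norm_num) (by positivity),
    Real.log_mul (by positivity) (by positivity), hlogC]
  have hH : ((k : ℝ) + j) * binEnt (k / (k + j)) * Real.log 2 =
      (k + j) * Real.log (k + j) - k * Real.log k - j * Real.log j := by
    have e2 : 1 - (k : ℝ) / (k + j) = j / (k + j) := by field_simp; ring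
    have h2 : Real.log 2 ≠ 0 := (Real.log_pos (by norm_num)).ne'
    unfold binEnt Real.logb
    rw [e2, Real.log_div hk.ne' hkj.ne', Real.log_div hj.ne' hkj.ne']
    field_simp
    ring
  have hq : ((k : ℝ) + j) / (12 * (k * j)) = 1 / (12 * k) + 1 / (12 * j) := by
    field_simp
    ring
  rw [hH, hq]
  linarith
end

section
/- g(1, 1-q_1) = 0, and for every (\alpha, \beta) \in D one has g(\alpha, \beta) \leq 0; that is, g attains its maximum value 0 on D at the point (\alpha, \beta) = (1, 1-q_1). -/
/-- The exponent function
`g(α,β) = log₂ E + αρ log₂ W + H(β) + (1 + αρ - β) H(1/(1 + αρ - β)) + β log₂ F`,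
where `W = (1-q₁)q₂/(1-q₁q₂)`, `E = q₁(1-q₂)/(1-q₁q₂)`, `F = (1-q₁q₂)/(q₁q₂)` and
`ρ = (1-q₁)/(1-q₂)`. -/
noncomputable def g (q1 q2 α β : ℝ) : ℝ :=
  Real.logb 2 (q1 * (1 - q2) / (1 - q1 * q2)) +
    α * ((1 - q1) / (1 - q2)) * Real.logb 2 ((1 - q1) * q2 / (1 - q1 * q2)) +
    binEnt β +
    (1 + α * ((1 - q1) / (1 - q2)) - β) *
      binEnt (1 / (1 + α * ((1 - q1) / (1 - q2)) - β)) +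
    β * Real.logb 2 ((1 - q1 * q2) / (q1 * q2))

lemma g_key (q1 q2 α β s : ℝ) (h1 : 0 < q1) (h1' : q1 < 1) (h2 : 0 < q2) (h2' : q2 < 1)
    (hs : 0 < s) (hsα : α * ((1 - q1) / (1 - q2)) = s + β) :
    g q1 q2 α β =
      ((β * Real.log (1 - q1) - β * Real.log β)
        + ((1 - β) * Real.log q1 - (1 - β) * Real.log (1 - β))
        + (s * (Real.log (1 - q1) + Real.log q2 - Real.log (1 - q1 * q2) + Real.log (1 + s))
            - s * Real.log s)
        + (Real.log (1 - q2) - Real.log (1 - q1 * q2) + Real.log (1 + s))) / Real.log 2 := by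
  have a1 : 0 < 1 - q1 := by linarith
  have a2 : 0 < 1 - q2 := by linarith
  have a3 : 0 < 1 - q1 * q2 := by nlinarith
  have a4 : 0 < 1 + s := by linarith
  have l2 : 0 < Real.log 2 := Real.log_pos (by norm_num)
  have e1 : 1 + (s + β) - β = 1 + s := by ring
  have e2 : 1 - 1 / (1 + s) = s / (1 + s) := by field_simp; ring
  unfold g binEnt
  rw [hsα, e1, e2]
  simp only [Real.logb]
  rw [Real.log_div (by positivity) a3.ne', Real.log_div (by positivity) a3.ne',
    Real.log_div a3.ne' (by positivity), Real.log_div hs.ne' a4.ne',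
    Real.log_div one_ne_zero a4.ne', Real.log_one, Real.log_mul h1.ne' a2.ne',
    Real.log_mul a1.ne' h2.ne', Real.log_mul h1.ne' h2.ne']
  field_simp
  ring

lemma log_gibbs (a x : ℝ) (ha : 0 < a) (hx : 0 < x) :
    a * Real.log x - a * Real.log a ≤ x - a := by
  have h := Real.log_le_sub_one_of_pos (div_pos hx ha)
  rw [Real.log_div hx.ne' ha.ne'] at h
  have h' := mul_le_mul_of_nonneg_left h ha.le
  have e : a * (x / a - 1) = x - a := by field_simp
  linarith

theorem g_max_at_corner (q1 q2 : ℝ)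
    (hq1 : q1 ∈ Set.Ioo (0 : ℝ) 1) (hq2 : q2 ∈ Set.Ioo (0 : ℝ) 1) :
    g q1 q2 1 (1 - q1) = 0 ∧
    ∀ α β : ℝ, 0 < β → β < 1 → β * (1 - q2) < α * (1 - q1) → g q1 q2 α β ≤ 0 := by
  obtain ⟨h1, h1'⟩ := hq1
  obtain ⟨h2, h2'⟩ := hq2
  have a1 : 0 < 1 - q1 := by linarith
  have a2 : 0 < 1 - q2 := by linarith
  have a3 : 0 < 1 - q1 * q2 := by nlinarith
  have l2 : 0 < Real.log 2 := Real.log_pos (by norm_num)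
  constructor
  · rw [g_key q1 q2 1 (1 - q1) ((1 - q1) * q2 / (1 - q2)) h1 h1' h2 h2' (by positivity)
      (by field_simp; ring)]
    have e : 1 + (1 - q1) * q2 / (1 - q2) = (1 - q1 * q2) / (1 - q2) := by field_simp; ring
    have e' : 1 - (1 - q1) = q1 := by ring
    rw [e, e', Real.log_div a3.ne' a2.ne', Real.log_div (by positivity) a2.ne',
      Real.log_mul a1.ne' h2.ne']
    ring
  · intro α β hb hb' h
    have hs : 0 < α * ((1 - q1) / (1 - q2)) - β := by
      rw [← mul_div_assoc, sub_pos, lt_div_iff₀ a2]; exact h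
    obtain ⟨s, hsd⟩ : ∃ s, s = α * ((1 - q1) / (1 - q2)) - β := ⟨_, rfl⟩
    rw [← hsd] at hs
    have a4 : 0 < 1 + s := by linarith
    rw [g_key q1 q2 α β s h1 h1' h2 h2' hs (by linarith)]
    apply div_nonpos_of_nonpos_of_nonneg _ l2.le
    have i1 := log_gibbs β (1 - q1) hb a1
    have i2 := log_gibbs (1 - β) q1 (by linarith) h1
    have i3 := log_gibbs s ((1 - q1) * q2 / (1 - q1 * q2) * (1 + s)) hs (by positivity)
    have i4 := log_gibbs 1 ((1 - q2) / (1 - q1 * q2) * (1 + s)) one_pos (by positivity)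
    rw [Real.log_mul (by positivity) a4.ne', Real.log_div (by positivity) a3.ne',
      Real.log_mul a1.ne' h2.ne'] at i3
    rw [Real.log_mul (by positivity) a4.ne', Real.log_div (by positivity) a3.ne',
      Real.log_one] at i4
    have e : (1 - q1) * q2 / (1 - q1 * q2) * (1 + s) + (1 - q2) / (1 - q1 * q2) * (1 + s)
        = 1 + s := by field_simp; ring
    linarith
end

section
/- At every point (\alpha, \beta) \in D, the second partial derivative of g with respect to \alpha exists and equals \frac{\partial^2 g}{\partial \alpha^2}(\alpha,\beta) = -\frac{(1-q_1)^2}{[\alpha(1-q_1) - \beta(1-q_2)]\,[\alpha(1-q_1) + (1-\beta)(1-q_2)]\,\ln 2}, which is strictly negative on D. -/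
theorem ent_aux (n : ℝ) (hn : 1 < n) :
    n * binEnt (1 / n) = (n * Real.log n - (n - 1) * Real.log (n - 1)) / Real.log 2 := by
  have h0 : n ≠ 0 := by linarith
  have h1 : n - 1 ≠ 0 := by linarith
  have h2 : Real.log 2 ≠ 0 := (Real.log_pos (by norm_num)).ne'
  have e : 1 - 1 / n = (n - 1) / n := by field_simp
  unfold binEnt Real.logb
  rw [e, Real.log_div h1 h0, Real.log_div one_ne_zero h0, Real.log_one]
  field_simp
  ring

theorem g_deriv_aux (q1 q2 a β : ℝ) (h : 1 < 1 + a * ((1 - q1) / (1 - q2)) - β) :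
    HasDerivAt (fun a' => g q1 q2 a' β)
      ((1 - q1) / (1 - q2) * Real.logb 2 ((1 - q1) * q2 / (1 - q1 * q2)) +
        (1 - q1) / (1 - q2) * (Real.log (1 + a * ((1 - q1) / (1 - q2)) - β) -
          Real.log (1 + a * ((1 - q1) / (1 - q2)) - β - 1)) / Real.log 2) a := by
  unfold g
  generalize (1 - q1) / (1 - q2) = r at *
  have hn : HasDerivAt (fun x : ℝ => 1 + x * r - β) r a := by
    simpa using (((hasDerivAt_id a).mul_const r).const_add 1).sub_const β
  have h0 : 1 + a * r - β ≠ 0 := by linarith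
  have h1 : 1 + a * r - β - 1 ≠ 0 := by linarith
  have hm := hn.sub_const 1
  have hE : HasDerivAt (fun x : ℝ => (1 + x * r - β) * binEnt (1 / (1 + x * r - β)))
      (r * (Real.log (1 + a * r - β) - Real.log (1 + a * r - β - 1)) / Real.log 2) a := by
    have k := ((hn.mul (hn.log h0)).sub (hm.mul (hm.log h1))).div_const (Real.log 2)
    have k2 := k.congr_of_eventuallyEq
      (f₁ := fun x : ℝ => (1 + x * r - β) * binEnt (1 / (1 + x * r - β))) (by
        filter_upwards [hn.continuousAt.eventually (lt_mem_nhds h)] with x hx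
        exact ent_aux _ hx)
    refine k2.congr_deriv ?_
    rw [mul_div_cancel₀ r h0, mul_div_cancel₀ r h1]
    ring
  have hL : HasDerivAt (fun x : ℝ => x * r * Real.logb 2 ((1 - q1) * q2 / (1 - q1 * q2)))
      (r * Real.logb 2 ((1 - q1) * q2 / (1 - q1 * q2))) a := by
    simpa using ((hasDerivAt_id a).mul_const r).mul_const
      (Real.logb 2 ((1 - q1) * q2 / (1 - q1 * q2)))
  exact (((hL.const_add _).add_const _).add hE).add_const _

/-- For `q₁, q₂ ∈ (0,1)`, at every point `(α,β)` of the domain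
`D = {(α,β) : 0 < β < 1, α(1-q₁) > β(1-q₂)}`, the second partial derivative of `g` with
respect to `α` exists and equals
`∂²g/∂α² = -(1-q₁)² / ([α(1-q₁) - β(1-q₂)][α(1-q₁) + (1-β)(1-q₂)] ln 2)`, which is
strictly negative on `D`. -/
theorem g_second_deriv_alpha (q1 q2 : ℝ)
    (hq1 : q1 ∈ Set.Ioo (0 : ℝ) 1) (hq2 : q2 ∈ Set.Ioo (0 : ℝ) 1) :
    ∀ α β : ℝ, 0 < β → β < 1 → β * (1 - q2) < α * (1 - q1) →
      HasDerivAt (fun a => deriv (fun a' => g q1 q2 a' β) a)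
        (-((1 - q1) ^ 2 /
          ((α * (1 - q1) - β * (1 - q2)) * (α * (1 - q1) + (1 - β) * (1 - q2)) *
            Real.log 2))) α ∧
      -((1 - q1) ^ 2 /
          ((α * (1 - q1) - β * (1 - q2)) * (α * (1 - q1) + (1 - β) * (1 - q2)) *
            Real.log 2)) < 0 := by
  intro α β hb0 hb1 h
  have hp1 : 0 < 1 - q1 := by linarith [hq1.2]
  have hp2 : 0 < 1 - q2 := by linarith [hq2.2]
  have hl : 0 < Real.log 2 := Real.log_pos (by norm_num)
  have hA : 0 < α * (1 - q1) - β * (1 - q2) := by linarith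
  have hB : 0 < α * (1 - q1) + (1 - β) * (1 - q2) := by linarith
  refine ⟨?_, by rw [neg_lt_zero]; positivity⟩
  have hn1 : 1 + α * ((1 - q1) / (1 - q2)) - β - 1
      = (α * (1 - q1) - β * (1 - q2)) / (1 - q2) := by field_simp; ring
  have hn0 : 1 + α * ((1 - q1) / (1 - q2)) - β
      = (α * (1 - q1) + (1 - β) * (1 - q2)) / (1 - q2) := by field_simp; ring
  have hpos : 1 < 1 + α * ((1 - q1) / (1 - q2)) - β := by
    have := div_pos hA hp2
    linarith
  have hn : HasDerivAt (fun x : ℝ => 1 + x * ((1 - q1) / (1 - q2)) - β)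
      ((1 - q1) / (1 - q2)) α := by
    simpa using (((hasDerivAt_id α).mul_const ((1 - q1) / (1 - q2))).const_add 1).sub_const β
  have hm := hn.sub_const 1
  have k := ((((hn.log (by linarith)).sub (hm.log (by linarith))).const_mul
    ((1 - q1) / (1 - q2))).div_const (Real.log 2)).const_add
      ((1 - q1) / (1 - q2) * Real.logb 2 ((1 - q1) * q2 / (1 - q1 * q2)))
  have k2 := k.congr_of_eventuallyEq
    (f₁ := fun a => deriv (fun a' => g q1 q2 a' β) a) (by
      filter_upwards [hn.continuousAt.eventually (lt_mem_nhds hpos)] with x hx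
      exact (g_deriv_aux q1 q2 x β hx).deriv)
  refine k2.congr_deriv ?_
  rw [hn1, hn0]
  have hAB : α * (1 - q1) + (1 - β) * (1 - q2) =
      (α * (1 - q1) - β * (1 - q2)) + (1 - q2) := by ring
  rw [hAB] at hB ⊢
  generalize α * (1 - q1) - β * (1 - q2) = A at hA hB ⊢
  generalize 1 - q2 = p at hp2 hB ⊢
  have hAne := hA.ne'
  have hBne := hB.ne'
  field_simp
  ring
end

section
/- At every point (\alpha, \beta) \in D, the determinant of the Hessian of g satisfies \frac{\partial^2 g}{\partial \alpha^2}\cdot\frac{\partial^2 g}{\partial \beta^2} - \left(\frac{\partial^2 g}{\partial \alpha \partial \beta}\right)^2 = \frac{(1-q_1)^2}{\beta(1-\beta)\,[\alpha(1-q_1) + (1-\beta)(1-q_2)]\,[\alpha(1-q_1) - \beta(1-q_2)]\,(\ln 2)^2}, which is strictly positive on D; together with the negativity of \partial^2 g/\partial\alpha^2, this shows that g is concave on D. -/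
/-- The one-variable function `(t+1) ln (t+1) - t ln t`. -/
noncomputable def auxF (t : ℝ) : ℝ := (t + 1) * Real.log (t + 1) - t * Real.log t

lemma auxF_hasDerivAt {t : ℝ} (ht : 0 < t) :
    HasDerivAt auxF (Real.log (t + 1) - Real.log t) t := by
  have h1 : HasDerivAt (fun t : ℝ => t + 1) 1 t := (hasDerivAt_id t).add_const 1
  have h2 := (Real.hasDerivAt_mul_log (x := t + 1) (by positivity)).comp t h1
  have h3 := Real.hasDerivAt_mul_log (x := t) ht.ne'
  have h4 := h2.sub h3
  refine h4.congr_deriv ?_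
  ring

lemma auxF_concave : ConcaveOn ℝ (Set.Ioi 0) auxF := by
  have hd : ∀ t ∈ Set.Ioi (0 : ℝ), deriv auxF t = Real.log (t + 1) - Real.log t :=
    fun t ht => (auxF_hasDerivAt ht).deriv
  apply AntitoneOn.concaveOn_of_deriv (convex_Ioi 0)
  · exact fun t ht => (auxF_hasDerivAt ht).continuousAt.continuousWithinAt
  · rw [interior_Ioi]
    exact fun t ht => (auxF_hasDerivAt ht).differentiableAt.differentiableWithinAt
  · rw [interior_Ioi]
    intro x hx y hy hxy
    rw [hd x hx, hd y hy]
    have hx' : (0 : ℝ) < x := hx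
    have hy' : (0 : ℝ) < y := hy
    rw [← Real.log_div (by positivity) (by positivity),
      ← Real.log_div (by positivity) (by positivity)]
    apply Real.log_le_log (by positivity)
    rw [div_le_div_iff₀ hy' hx']
    nlinarith

lemma mul_binEnt_inv {t : ℝ} (ht : 0 < t) :
    (t + 1) * binEnt (1 / (t + 1)) = auxF t / Real.log 2 := by
  have h1 : (1 : ℝ) - 1 / (t + 1) = t / (t + 1) := by field_simp; ring
  have h2 : (t + 1 : ℝ) ≠ 0 := by positivity
  unfold binEnt auxF Real.logb
  rw [h1, Real.log_div one_ne_zero h2, Real.log_div ht.ne' h2, Real.log_one]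
  have : Real.log 2 ≠ 0 := (Real.log_pos one_lt_two).ne'
  field_simp
  ring

/-- A simplified form of `g`. -/
lemma g_eq (q1 q2 α β : ℝ) (h : 0 < α * ((1 - q1) / (1 - q2)) - β) :
    g q1 q2 α β = Real.logb 2 (q1 * (1 - q2) / (1 - q1 * q2)) +
      α * ((1 - q1) / (1 - q2)) * Real.logb 2 ((1 - q1) * q2 / (1 - q1 * q2)) +
      β * Real.logb 2 ((1 - q1 * q2) / (q1 * q2)) +
      (Real.negMulLog β + Real.negMulLog (1 - β) +
        auxF (α * ((1 - q1) / (1 - q2)) - β)) / Real.log 2 := by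
  have h1 : 1 + α * ((1 - q1) / (1 - q2)) - β = (α * ((1 - q1) / (1 - q2)) - β) + 1 := by ring
  unfold g
  rw [h1, mul_binEnt_inv h]
  unfold binEnt Real.negMulLog Real.logb
  ring

lemma g_hasDerivAt_left (q1 q2 α β : ℝ) (h : 0 < α * ((1 - q1) / (1 - q2)) - β) :
    HasDerivAt (fun a => g q1 q2 a β)
      ((1 - q1) / (1 - q2) * Real.logb 2 ((1 - q1) * q2 / (1 - q1 * q2)) +
        (Real.log (α * ((1 - q1) / (1 - q2)) - β + 1) -
          Real.log (α * ((1 - q1) / (1 - q2)) - β)) * ((1 - q1) / (1 - q2)) / Real.log 2) α := by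
  have hev : ∀ᶠ a in nhds α, 0 < a * ((1 - q1) / (1 - q2)) - β :=
    (by fun_prop : Continuous fun a : ℝ => a * ((1 - q1) / (1 - q2)) - β).continuousAt.eventually_const_lt h
  have hl : HasDerivAt (fun a : ℝ => a * ((1 - q1) / (1 - q2))) ((1 - q1) / (1 - q2)) α := by
    simpa using (hasDerivAt_id α).mul_const ((1 - q1) / (1 - q2))
  have hF := (auxF_hasDerivAt h).comp α (hl.sub_const β)
  have hT := (((hl.mul_const (Real.logb 2 ((1 - q1) * q2 / (1 - q1 * q2)))).const_add
    (Real.logb 2 (q1 * (1 - q2) / (1 - q1 * q2)))).add_const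
      (β * Real.logb 2 ((1 - q1 * q2) / (q1 * q2)))).add
      ((hF.const_add (Real.negMulLog β + Real.negMulLog (1 - β))).div_const (Real.log 2))
  refine hT.congr_of_eventuallyEq ?_
  filter_upwards [hev] with a ha
  exact g_eq q1 q2 a β ha

lemma g_hasDerivAt_right (q1 q2 α β : ℝ) (h0 : 0 < β) (h1 : β < 1)
    (h : 0 < α * ((1 - q1) / (1 - q2)) - β) :
    HasDerivAt (fun b => g q1 q2 α b)
      (Real.logb 2 ((1 - q1 * q2) / (q1 * q2)) +
        (-Real.log β + Real.log (1 - β) - (Real.log (α * ((1 - q1) / (1 - q2)) - β + 1) -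
          Real.log (α * ((1 - q1) / (1 - q2)) - β))) / Real.log 2) β := by
  have hev : ∀ᶠ b in nhds β, 0 < α * ((1 - q1) / (1 - q2)) - b :=
    (by fun_prop : Continuous fun b : ℝ => α * ((1 - q1) / (1 - q2)) - b).continuousAt.eventually_const_lt h
  have hF := (auxF_hasDerivAt h).comp β ((hasDerivAt_id β).const_sub (α * ((1 - q1) / (1 - q2))))
  have hN1 := Real.hasDerivAt_negMulLog h0.ne'
  have hN2 := (Real.hasDerivAt_negMulLog (x := 1 - β) (by linarith)).comp β
    ((hasDerivAt_id β).const_sub 1)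
  have hL : HasDerivAt (fun b : ℝ => b * Real.logb 2 ((1 - q1 * q2) / (q1 * q2)))
      (Real.logb 2 ((1 - q1 * q2) / (q1 * q2))) β := by
    simpa using (hasDerivAt_id β).mul_const (Real.logb 2 ((1 - q1 * q2) / (q1 * q2)))
  have hT := (hL.const_add (Real.logb 2 (q1 * (1 - q2) / (1 - q1 * q2)) +
      α * ((1 - q1) / (1 - q2)) * Real.logb 2 ((1 - q1) * q2 / (1 - q1 * q2)))).add
      (((hN1.add hN2).add hF).div_const (Real.log 2))
  refine (hT.congr_of_eventuallyEq ?_).congr_deriv ?_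
  · filter_upwards [hev] with b hb
    exact g_eq q1 q2 α b hb
  · ring

lemma g_deriv_aa (q1 q2 α β : ℝ) (h : 0 < α * ((1 - q1) / (1 - q2)) - β) :
    deriv (fun a => deriv (fun a' => g q1 q2 a' β) a) α =
      ((1 - q1) / (1 - q2)) ^ 2 * ((α * ((1 - q1) / (1 - q2)) - β + 1)⁻¹ -
        (α * ((1 - q1) / (1 - q2)) - β)⁻¹) / Real.log 2 := by
  have hev : ∀ᶠ a in nhds α, 0 < a * ((1 - q1) / (1 - q2)) - β :=
    (by fun_prop : Continuous fun a : ℝ => a * ((1 - q1) / (1 - q2)) - β).continuousAt.eventually_const_lt h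
  have hl : HasDerivAt (fun a : ℝ => a * ((1 - q1) / (1 - q2)) - β) ((1 - q1) / (1 - q2)) α := by
    simpa using ((hasDerivAt_id α).mul_const ((1 - q1) / (1 - q2))).sub_const β
  have hT := (((((hl.add_const 1).log (by positivity)).sub (hl.log h.ne')).mul_const
    ((1 - q1) / (1 - q2))).div_const (Real.log 2)).const_add
      ((1 - q1) / (1 - q2) * Real.logb 2 ((1 - q1) * q2 / (1 - q1 * q2)))
  refine ((hT.congr_of_eventuallyEq ?_).congr_deriv ?_).deriv
  · filter_upwards [hev] with a ha
    exact (g_hasDerivAt_left q1 q2 a β ha).deriv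
  · ring

lemma g_deriv_ab (q1 q2 α β : ℝ) (h : 0 < α * ((1 - q1) / (1 - q2)) - β) :
    deriv (fun b => deriv (fun a => g q1 q2 a b) α) β =
      -((1 - q1) / (1 - q2)) * ((α * ((1 - q1) / (1 - q2)) - β + 1)⁻¹ -
        (α * ((1 - q1) / (1 - q2)) - β)⁻¹) / Real.log 2 := by
  have hev : ∀ᶠ b in nhds β, 0 < α * ((1 - q1) / (1 - q2)) - b :=
    (by fun_prop : Continuous fun b : ℝ => α * ((1 - q1) / (1 - q2)) - b).continuousAt.eventually_const_lt h
  have hl : HasDerivAt (fun b : ℝ => α * ((1 - q1) / (1 - q2)) - b) (-1) β :=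
    (hasDerivAt_id β).const_sub _
  have hT := (((((hl.add_const 1).log (by positivity)).sub (hl.log h.ne')).mul_const
    ((1 - q1) / (1 - q2))).div_const (Real.log 2)).const_add
      ((1 - q1) / (1 - q2) * Real.logb 2 ((1 - q1) * q2 / (1 - q1 * q2)))
  refine ((hT.congr_of_eventuallyEq ?_).congr_deriv ?_).deriv
  · filter_upwards [hev] with b hb
    exact (g_hasDerivAt_left q1 q2 α b hb).deriv
  · ring

lemma g_deriv_bb (q1 q2 α β : ℝ) (h0 : 0 < β) (h1 : β < 1)
    (h : 0 < α * ((1 - q1) / (1 - q2)) - β) :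
    deriv (fun b => deriv (fun b' => g q1 q2 α b') b) β =
      (-β⁻¹ - (1 - β)⁻¹ + ((α * ((1 - q1) / (1 - q2)) - β + 1)⁻¹ -
        (α * ((1 - q1) / (1 - q2)) - β)⁻¹)) / Real.log 2 := by
  have hev : ∀ᶠ b in nhds β, 0 < α * ((1 - q1) / (1 - q2)) - b :=
    (by fun_prop : Continuous fun b : ℝ => α * ((1 - q1) / (1 - q2)) - b).continuousAt.eventually_const_lt h
  have hl : HasDerivAt (fun b : ℝ => α * ((1 - q1) / (1 - q2)) - b) (-1) β :=
    (hasDerivAt_id β).const_sub _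
  have hm : HasDerivAt (fun b : ℝ => 1 - b) (-1) β := (hasDerivAt_id β).const_sub _
  have hT := ((((Real.hasDerivAt_log h0.ne').neg.add (hm.log (by linarith))).sub
    (((hl.add_const 1).log (by positivity)).sub (hl.log h.ne'))).div_const (Real.log 2)).const_add
      (Real.logb 2 ((1 - q1 * q2) / (q1 * q2)))
  refine ((hT.congr_of_eventuallyEq ?_).congr_deriv ?_).deriv
  · filter_upwards [hev, lt_mem_nhds h0, gt_mem_nhds h1] with b hb hb0 hb1
    exact (g_hasDerivAt_right q1 q2 α b hb0 hb1 hb).deriv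
  · ring

/-- For `q₁, q₂ ∈ (0,1)`, at every point `(α,β)` of the domain
`D = {(α,β) : 0 < β < 1, α(1-q₁) > β(1-q₂)}`, the determinant of the Hessian of `g`
satisfies
`∂²g/∂α² · ∂²g/∂β² - (∂²g/∂α∂β)² =
  (1-q₁)² / (β(1-β)[α(1-q₁) + (1-β)(1-q₂)][α(1-q₁) - β(1-q₂)](ln 2)²)`,
which is strictly positive on `D`; together with the negativity of `∂²g/∂α²`, this shows
that `g` is concave on `D`. -/
theorem g_hessian_det_pos_and_concave (q1 q2 : ℝ)
    (hq1 : q1 ∈ Set.Ioo (0 : ℝ) 1) (hq2 : q2 ∈ Set.Ioo (0 : ℝ) 1) :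
    (∀ α β : ℝ, 0 < β → β < 1 → β * (1 - q2) < α * (1 - q1) →
      deriv (fun a => deriv (fun a' => g q1 q2 a' β) a) α *
          deriv (fun b => deriv (fun b' => g q1 q2 α b') b) β -
        (deriv (fun b => deriv (fun a => g q1 q2 a b) α) β) ^ 2 =
        (1 - q1) ^ 2 /
          (β * (1 - β) * (α * (1 - q1) + (1 - β) * (1 - q2)) *
            (α * (1 - q1) - β * (1 - q2)) * (Real.log 2) ^ 2) ∧
      0 < (1 - q1) ^ 2 /
          (β * (1 - β) * (α * (1 - q1) + (1 - β) * (1 - q2)) *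
            (α * (1 - q1) - β * (1 - q2)) * (Real.log 2) ^ 2)) ∧
    ConcaveOn ℝ {p : ℝ × ℝ | 0 < p.2 ∧ p.2 < 1 ∧ p.2 * (1 - q2) < p.1 * (1 - q1)}
      (fun p => g q1 q2 p.1 p.2) := by
  obtain ⟨h10, h11⟩ := hq1
  obtain ⟨h20, h21⟩ := hq2
  have hL : 0 < Real.log 2 := Real.log_pos one_lt_two
  have p1 : 0 < 1 - q1 := by linarith
  have p2 : 0 < 1 - q2 := by linarith
  have key : ∀ α β : ℝ, β * (1 - q2) < α * (1 - q1) → 0 < α * ((1 - q1) / (1 - q2)) - β := by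
    intro α β h
    rw [sub_pos, ← mul_div_assoc, lt_div_iff₀ p2]
    exact h
  refine ⟨fun α β h0 h1 h => ?_, ?_⟩
  · have ht := key α β h
    have hb : 0 < 1 - β := by linarith
    have hA : 0 < α * (1 - q1) - β * (1 - q2) := by linarith
    have hB : 0 < α * (1 - q1) + (1 - β) * (1 - q2) := by nlinarith
    refine ⟨?_, by positivity⟩
    rw [g_deriv_aa q1 q2 α β ht, g_deriv_ab q1 q2 α β ht, g_deriv_bb q1 q2 α β h0 h1 ht]
    have e1 : α * ((1 - q1) / (1 - q2)) - β = (α * (1 - q1) - β * (1 - q2)) / (1 - q2) := by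
      field_simp
    have e2 : α * ((1 - q1) / (1 - q2)) - β + 1 =
        (α * (1 - q1) + (1 - β) * (1 - q2)) / (1 - q2) := by
      field_simp
      ring
    rw [e2, e1, inv_div, inv_div]
    have e3 : α * (1 - q1) + (1 - β) * (1 - q2) =
      (α * (1 - q1) - β * (1 - q2)) + (1 - q2) := by ring
    rw [e3] at hB ⊢
    generalize α * (1 - q1) - β * (1 - q2) = A at *
    generalize 1 - q2 = r at *
    generalize 1 - q1 = s at *
    generalize Real.log 2 = L at *
    field_simp
    ring
  · have hconv : Convex ℝ
        {p : ℝ × ℝ | 0 < p.2 ∧ p.2 < 1 ∧ p.2 * (1 - q2) < p.1 * (1 - q1)} := by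
      rintro ⟨a, b⟩ ⟨x1, x2, x3⟩ ⟨a', b'⟩ ⟨y1, y2, y3⟩ u v hu hv huv
      simp only [Set.mem_setOf_eq, Prod.smul_mk, Prod.mk_add_mk, smul_eq_mul] at *
      have hv' : v = 1 - u := by linarith
      rcases hu.eq_or_lt with rfl | hu'
      · have : v = 1 := by linarith
        subst this
        refine ⟨by linarith, by linarith, by linarith⟩
      · have m1 := mul_pos hu' x1
        have m2 := mul_nonneg hv y1.le
        have m3 := mul_lt_mul_of_pos_left x2 hu'
        have m4 := mul_le_mul_of_nonneg_left y2.le hv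
        have m5 := mul_lt_mul_of_pos_left x3 hu'
        have m6 := mul_le_mul_of_nonneg_left y3.le hv
        refine ⟨by linarith, by linarith, by linarith⟩
    refine ⟨hconv, ?_⟩
    intro x hx y hy u v hu hv huv
    have hz := hconv hx hy hu hv huv
    obtain ⟨a, b⟩ := x
    obtain ⟨a', b'⟩ := y
    simp only [Set.mem_setOf_eq, Prod.smul_mk, Prod.mk_add_mk, smul_eq_mul] at *
    obtain ⟨x1, x2, x3⟩ := hx
    obtain ⟨y1, y2, y3⟩ := hy
    obtain ⟨z1, z2, z3⟩ := hz
    have tx := key _ _ x3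
    have ty := key _ _ y3
    rw [g_eq _ _ _ _ tx, g_eq _ _ _ _ ty, g_eq _ _ _ _ (key _ _ z3)]
    have c1 := Real.concaveOn_negMulLog.2 (x := b) x1.le (y := b') y1.le hu hv huv
    have c2 := Real.concaveOn_negMulLog.2 (x := 1 - b) (sub_nonneg.2 x2.le)
      (y := 1 - b') (sub_nonneg.2 y2.le) hu hv huv
    have c3 := auxF_concave.2 tx ty hu hv huv
    simp only [smul_eq_mul] at c1 c2 c3
    rw [show u * (1 - b) + v * (1 - b') = 1 - (u * b + v * b') by linear_combination huv] at c2
    generalize (1 - q1) / (1 - q2) = ρ at *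
    rw [show u * (a * ρ - b) + v * (a' * ρ - b') =
      (u * a + v * a') * ρ - (u * b + v * b') by ring] at c3
    have c := div_le_div_of_nonneg_right (add_le_add (add_le_add c1 c2) c3) hL.le
    have hu' : u = 1 - v := by linarith
    refine le_of_eq_of_le ?_ (add_le_add_right c
      (Real.logb 2 (q1 * (1 - q2) / (1 - q1 * q2)) +
      (u * a + v * a') * ρ * Real.logb 2 ((1 - q1) * q2 / (1 - q1 * q2)) +
      (u * b + v * b') * Real.logb 2 ((1 - q1 * q2) / (q1 * q2))))
    subst hu'
    ring
end

section
/- The function r(x) := g(1 - x, 1 - q_1 - x), defined for x in a neighborhood of 0, satisfies r(0) = 0 and r'(0) = 0. -/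
open Real in
lemma binEnt_persp (m : ℝ) (hm : 1 < m) :
    m * binEnt (1 / m) = (m * log m - (m - 1) * log (m - 1)) / log 2 := by
  have h0 : m ≠ 0 := by linarith
  have h1 : m - 1 ≠ 0 := by linarith
  have h2 : log 2 ≠ 0 := (log_pos (by norm_num)).ne'
  have e : 1 - 1 / m = (m - 1) / m := by field_simp
  unfold binEnt
  rw [e]
  simp only [logb]
  rw [log_div h1 h0, log_div one_ne_zero h0, log_one]
  field_simp
  ring

/-- For `q₁, q₂ ∈ (0,1)`, the function `r(x) = g(1-x, 1-q₁-x)`, defined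
for `x` in a neighborhood of `0`, satisfies `r(0) = 0` and `r'(0) = 0`. -/
theorem r_value_and_deriv_at_zero (q1 q2 : ℝ)
    (hq1 : q1 ∈ Set.Ioo (0 : ℝ) 1) (hq2 : q2 ∈ Set.Ioo (0 : ℝ) 1)
    (r : ℝ → ℝ) (hr : ∀ x : ℝ, r x = g q1 q2 (1 - x) (1 - q1 - x)) :
    r 0 = 0 ∧ HasDerivAt r 0 0 := by
  obtain ⟨h1, h1'⟩ := hq1
  obtain ⟨h2, h2'⟩ := hq2
  have h12 : 0 < 1 - q1 * q2 := by nlinarith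
  have p1 : 0 < 1 - q1 := by linarith
  have p2 : 0 < 1 - q2 := by linarith
  have hL : Real.log 2 ≠ 0 := (Real.log_pos (by norm_num)).ne'
  have hW : Real.log ((1 - q1) * q2 / (1 - q1 * q2)) =
      Real.log (1 - q1) + Real.log q2 - Real.log (1 - q1 * q2) := by
    rw [Real.log_div (by positivity) h12.ne', Real.log_mul p1.ne' h2.ne']
  have hE : Real.log (q1 * (1 - q2) / (1 - q1 * q2)) =
      Real.log q1 + Real.log (1 - q2) - Real.log (1 - q1 * q2) := by
    rw [Real.log_div (by positivity) h12.ne', Real.log_mul h1.ne' p2.ne']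
  have hF : Real.log ((1 - q1 * q2) / (q1 * q2)) =
      Real.log (1 - q1 * q2) - (Real.log q1 + Real.log q2) := by
    rw [Real.log_div h12.ne' (by positivity), Real.log_mul h1.ne' h2.ne']
  have hm0 : 1 + (1 - 0) * ((1 - q1) / (1 - q2)) - (1 - q1 - 0) = (1 - q1 * q2) / (1 - q2) := by
    field_simp
    ring
  have hs0 : 1 + (1 - 0) * ((1 - q1) / (1 - q2)) - (1 - q1 - 0) - 1
      = (1 - q1) * q2 / (1 - q2) := by
    field_simp
    ring
  have hlm : Real.log ((1 - q1 * q2) / (1 - q2)) =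
      Real.log (1 - q1 * q2) - Real.log (1 - q2) := Real.log_div h12.ne' p2.ne'
  have hls : Real.log ((1 - q1) * q2 / (1 - q2)) =
      Real.log (1 - q1) + Real.log q2 - Real.log (1 - q2) := by
    rw [Real.log_div (by positivity) p2.ne', Real.log_mul p1.ne' h2.ne']
  have hspos : 0 < (1 - q1) * q2 / (1 - q2) := by positivity
  have hmpos : 0 < (1 - q1 * q2) / (1 - q2) := by positivity
  -- closed form of `r`
  have key : ∀ x : ℝ, 1 < 1 + (1 - x) * ((1 - q1) / (1 - q2)) - (1 - q1 - x) →
      r x = (Real.log (q1 * (1 - q2) / (1 - q1 * q2)) +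
        (1 - x) * ((1 - q1) / (1 - q2)) * Real.log ((1 - q1) * q2 / (1 - q1 * q2)) +
        (-((1 - q1 - x) * Real.log (1 - q1 - x))
          - (1 - (1 - q1 - x)) * Real.log (1 - (1 - q1 - x))) +
        ((1 + (1 - x) * ((1 - q1) / (1 - q2)) - (1 - q1 - x)) *
            Real.log (1 + (1 - x) * ((1 - q1) / (1 - q2)) - (1 - q1 - x))
          - (1 + (1 - x) * ((1 - q1) / (1 - q2)) - (1 - q1 - x) - 1) *
            Real.log (1 + (1 - x) * ((1 - q1) / (1 - q2)) - (1 - q1 - x) - 1)) +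
        (1 - q1 - x) * Real.log ((1 - q1 * q2) / (q1 * q2))) / Real.log 2 := by
    intro x hx
    rw [hr, g, binEnt_persp _ hx]
    simp only [binEnt, Real.logb]
    ring
  have hx0 : 1 < 1 + (1 - 0) * ((1 - q1) / (1 - q2)) - (1 - q1 - 0) := by linarith
  constructor
  · rw [key 0 hx0, hs0, hm0, hW, hE, hF, hlm, hls]
    have e1 : 1 - (1 - q1 - 0) = q1 := by ring
    rw [e1, sub_zero (1 - q1)]
    field_simp
    ring
  · have hm : HasDerivAt (fun x : ℝ => 1 + (1 - x) * ((1 - q1) / (1 - q2)) - (1 - q1 - x))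
        (1 - (1 - q1) / (1 - q2)) 0 := by
      have := ((((hasDerivAt_id (0:ℝ)).const_sub 1).mul_const ((1 - q1) / (1 - q2))).const_add
        1).sub ((hasDerivAt_id (0:ℝ)).const_sub (1 - q1))
      refine this.congr_deriv ?_
      ring
    have hb : HasDerivAt (fun x : ℝ => 1 - q1 - x) (-1) 0 :=
      (hasDerivAt_id (0:ℝ)).const_sub (1 - q1)
    have ha : HasDerivAt (fun x : ℝ => 1 - x) (-1) 0 := (hasDerivAt_id (0:ℝ)).const_sub 1
    have hev : ∀ᶠ x in nhds (0:ℝ),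
        1 < 1 + (1 - x) * ((1 - q1) / (1 - q2)) - (1 - q1 - x) :=
      hm.continuousAt.eventually (lt_mem_nhds hx0)
    have hevr := hev.mono key
    refine HasDerivAt.congr_of_eventuallyEq ?_ hevr
    have hs := hm.sub_const 1
    have hc := hb.const_sub 1
    have e1 : 1 - (1 - q1 - 0) = q1 := by ring
    have D := ((((((ha.mul_const ((1 - q1) / (1 - q2))).mul_const
      (Real.log ((1 - q1) * q2 / (1 - q1 * q2)))).const_add
      (Real.log (q1 * (1 - q2) / (1 - q1 * q2)))).add
      ((hb.mul (hb.log (by rw [sub_zero]; exact p1.ne'))).neg.sub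
        (hc.mul (hc.log (by rw [e1]; exact h1.ne'))))).add
      ((hm.mul (hm.log (by rw [hm0]; exact hmpos.ne'))).sub
        (hs.mul (hs.log (by rw [hs0]; exact hspos.ne'))))).add
      (hb.mul_const (Real.log ((1 - q1 * q2) / (q1 * q2))))).div_const (Real.log 2)
    refine D.congr_deriv ?_
    rw [hs0, hm0, hW, hF, hlm, hls, e1, sub_zero (1 - q1)]
    field_simp
    ring
end

section
/- For every real x with x - A\sqrt{x} - 1 > 0, one has \omega(x) > A^2/2. -/
/-- Fix `A > 0` and let
`ω(x) = x ln(x / (x - A√x - 1)) - A√x - 1` on `{x : x - A√x - 1 > 0}`.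
Then for every real `x` with `x - A√x - 1 > 0`, one has `ω(x) > A²/2`. -/
theorem omega_gt (A : ℝ) (hA : 0 < A) (ω : ℝ → ℝ)
    (hω : ∀ x : ℝ, ω x = x * Real.log (x / (x - A * Real.sqrt x - 1)) - A * Real.sqrt x - 1) :
    ∀ x : ℝ, 0 < x - A * Real.sqrt x - 1 → A ^ 2 / 2 < ω x := by
  intro x hx
  rw [hω]
  have hs0 : 0 ≤ Real.sqrt x := Real.sqrt_nonneg x
  have hAs : 0 ≤ A * Real.sqrt x := mul_nonneg hA.le hs0
  have hx0 : 0 < x := by linarith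
  have hsp : 0 < Real.sqrt x := Real.sqrt_pos.mpr hx0
  have hsq : Real.sqrt x ^ 2 = x := Real.sq_sqrt hx0.le
  set s := Real.sqrt x with hs
  obtain ⟨u, hu⟩ : ∃ u, u = (A * s + 1) / x := ⟨_, rfl⟩
  have hxu : x * u = A * s + 1 := by rw [hu]; field_simp
  have hu0 : 0 < u := by rw [hu]; positivity
  have hu1 : u < 1 := by rw [hu, div_lt_one hx0]; linarith
  have hlog : u + u ^ 2 / 2 ≤ -Real.log (1 - u) := by
    have h := Real.hasSum_pow_div_log_of_abs_lt_one (x := u) (by rw [abs_of_pos hu0]; exact hu1)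
    have h2 := sum_le_hasSum (Finset.range 2) (fun i _ => by positivity) h
    norm_num [Finset.sum_range_succ] at h2
    linarith
  have he : x / (x - A * s - 1) = (1 - u)⁻¹ := by
    have : x - A * s - 1 = x * (1 - u) := by linarith
    rw [this]
    have : 1 - u ≠ 0 := by linarith
    field_simp
  rw [he, Real.log_inv]
  have h3 := mul_le_mul_of_nonneg_left hlog hx0.le
  have h4 : A ^ 2 < x * u ^ 2 := by
    have h5 : x * A ^ 2 < x * (x * u ^ 2) := by
      have : x * (x * u ^ 2) = (A * s + 1) ^ 2 := by rw [← hxu]; ring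
      rw [this]
      have : x * A ^ 2 = (A * s) ^ 2 := by rw [mul_pow, hsq]; ring
      rw [this]
      nlinarith
    exact lt_of_mul_lt_mul_left h5 hx0.le
  nlinarith
end

section
/- On the domain \{x : x - A\sqrt{x} - 1 > 0\}, the function \omega is twice differentiable and its second derivative equals \omega''(x) = \frac{A(A^2+3)\,x + 2(A^2+2)\sqrt{x} + A}{4\,(x - A\sqrt{x} - 1)^2\, x^{3/2}}, which is strictly positive; in particular \omega is strictly convex on this domain. -/
/-- Fix `A > 0` and let
`ω(x) = x ln(x / (x - A√x - 1)) - A√x - 1` on the domain `{x : x - A√x - 1 > 0}`.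
On this domain `ω` is twice differentiable and
`ω''(x) = (A(A²+3)x + 2(A²+2)√x + A) / (4 (x - A√x - 1)² x^{3/2})`,
which is strictly positive; in particular `ω` is strictly convex on this domain. -/
theorem omega_second_deriv_and_convex (A : ℝ) (hA : 0 < A) (ω : ℝ → ℝ)
    (hω : ∀ x : ℝ, ω x = x * Real.log (x / (x - A * Real.sqrt x - 1)) - A * Real.sqrt x - 1) :
    (∀ x : ℝ, 0 < x - A * Real.sqrt x - 1 →
      DifferentiableAt ℝ ω x ∧
      HasDerivAt (deriv ω)
        ((A * (A ^ 2 + 3) * x + 2 * (A ^ 2 + 2) * Real.sqrt x + A) /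
          (4 * (x - A * Real.sqrt x - 1) ^ 2 * x ^ ((3 : ℝ) / 2))) x ∧
      0 < (A * (A ^ 2 + 3) * x + 2 * (A ^ 2 + 2) * Real.sqrt x + A) /
          (4 * (x - A * Real.sqrt x - 1) ^ 2 * x ^ ((3 : ℝ) / 2))) ∧
    StrictConvexOn ℝ {x : ℝ | 0 < x - A * Real.sqrt x - 1} ω := by
  have hpos : ∀ x : ℝ, 0 < x - A * Real.sqrt x - 1 → 0 < x := by
    intro x hx
    have := mul_nonneg hA.le (Real.sqrt_nonneg x)
    linarith
  have hopen : IsOpen {x : ℝ | 0 < x - A * Real.sqrt x - 1} := by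
    apply isOpen_lt <;> fun_prop
  have hD : ∀ x : ℝ, 0 < x - A * Real.sqrt x - 1 →
      HasDerivAt (fun x => x - A * Real.sqrt x - 1) (1 - A * (1 / (2 * Real.sqrt x))) x := by
    intro x hx
    exact ((hasDerivAt_id x).sub ((Real.hasDerivAt_sqrt (hpos x hx).ne').const_mul A)).sub_const 1
  have h1 : ∀ x : ℝ, 0 < x - A * Real.sqrt x - 1 → HasDerivAt ω
      (Real.log x - Real.log (x - A * Real.sqrt x - 1) + 1
        - x * (1 - A * (1 / (2 * Real.sqrt x))) / (x - A * Real.sqrt x - 1)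
        - A * (1 / (2 * Real.sqrt x))) x := by
    intro x hx
    have hx0 := hpos x hx
    have h := (((hasDerivAt_id x).mul ((Real.hasDerivAt_log hx0.ne').sub
      ((hD x hx).log hx.ne'))).sub
      ((Real.hasDerivAt_sqrt hx0.ne').const_mul A)).sub_const 1
    have h' := h.congr_of_eventuallyEq (f₁ := ω) (by
      filter_upwards [hopen.mem_nhds hx] with y hy
      have hy' : 0 < y - A * Real.sqrt y - 1 := hy
      rw [hω y, Real.log_div (hpos y hy').ne' hy'.ne']
      simp)
    refine h'.congr_deriv ?_
    simp only [Pi.sub_apply, id]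
    field_simp
    ring
  have h2 : ∀ x : ℝ, 0 < x - A * Real.sqrt x - 1 → HasDerivAt (deriv ω)
        ((A * (A ^ 2 + 3) * x + 2 * (A ^ 2 + 2) * Real.sqrt x + A) /
          (4 * (x - A * Real.sqrt x - 1) ^ 2 * x ^ ((3 : ℝ) / 2))) x := by
    intro x hx
    have hx0 := hpos x hx
    have hs0 := Real.sqrt_pos.2 hx0
    have hsq := Real.hasDerivAt_sqrt hx0.ne'
    have hinv := (((hsq.const_mul 2).fun_inv (by positivity)).const_mul A)
    have hD1 := hinv.const_sub 1
    have h := ((((Real.hasDerivAt_log hx0.ne').fun_sub ((hD x hx).log hx.ne')).add_const 1).fun_sub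
      (((hasDerivAt_id' x).fun_mul hD1).fun_div (hD x hx) hx.ne')).fun_sub hinv
    have h' := h.congr_of_eventuallyEq (f₁ := deriv ω) (by
      filter_upwards [hopen.mem_nhds hx] with y hy
      rw [(h1 y hy).deriv]
      simp only [one_div])
    refine h'.congr_deriv ?_
    have e : x ^ ((3 : ℝ) / 2) = Real.sqrt x ^ 3 := by
      rw [Real.sqrt_eq_rpow, ← Real.rpow_natCast, ← Real.rpow_mul hx0.le]
      norm_num
    rw [e]
    have hxs : x = Real.sqrt x ^ 2 := (Real.sq_sqrt hx0.le).symm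
    generalize Real.sqrt x = s at *
    subst hxs
    have hx' := hx.ne'
    clear h h' hsq hinv hD1 e hx
    generalize hd : s ^ 2 - A * s - 1 = d at *
    field_simp
    rw [← hd]
    ring
  have h3 : ∀ x : ℝ, 0 < x - A * Real.sqrt x - 1 →
      0 < (A * (A ^ 2 + 3) * x + 2 * (A ^ 2 + 2) * Real.sqrt x + A) /
          (4 * (x - A * Real.sqrt x - 1) ^ 2 * x ^ ((3 : ℝ) / 2)) := by
    intro x hx
    have hx0 := hpos x hx
    positivity
  refine ⟨fun x hx => ⟨(h1 x hx).differentiableAt, h2 x hx, h3 x hx⟩, ?_⟩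
  apply strictConvexOn_of_deriv2_pos'
  · apply Set.OrdConnected.convex
    constructor
    rintro x hx z hz y ⟨hxy, hyz⟩
    have hx' : 0 < x - A * Real.sqrt x - 1 := hx
    show 0 < y - A * Real.sqrt y - 1
    have hx0 := hpos x hx'
    have hst := Real.sqrt_le_sqrt hxy
    have hs := Real.sq_sqrt hx0.le
    have ht := Real.sq_sqrt (hx0.le.trans hxy)
    have hs0 := Real.sqrt_pos.2 hx0
    have hsA : A < Real.sqrt x := by
      by_contra hc
      push Not at hc
      nlinarith
    nlinarith
  · intro x hx
    exact (h1 x hx).continuousAt.continuousWithinAt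
  · intro x hx
    have : deriv^[2] ω x = deriv (deriv ω) x := rfl
    rw [this, (h2 x hx).deriv]
    exact h3 x hx
end
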